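/- For every ε ∈ (0, 1/100) and every A > 100 there exists a constant C = C(A,ε) > 0 such that for all real X ≥ 2 and all real H ≥ 3: the number of positive integers q ≤ X with Σ_{p prime, p∣q} 1/p ≥ (1−ε) Σ_{p prime, p≤H} 1/p is at most C · X · (log H)^{−A}. -/

import Mathlib

open Filter Topology

noncomputable def primeVol (q : ℕ) : ℝ := ∑ p ∈ q.primeFactors, (1 : ℝ) / p

/-- sum of 1/p over primes p ≤ H -/
noncomputable def primeSumUpTo (H : ℝ) : ℝ :=
  ∑ p ∈ (Finset.Iic ⌊H⌋₊).filter Nat.Prime, (1 : ℝ) / p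

lemma sum_inv_sq_le (s : Finset ℕ) :
    ∑ p ∈ s, ((p : ℝ) ^ 2)⁻¹ ≤ ∑' n : ℕ, ((n : ℝ) ^ 2)⁻¹ := by
  have h : Summable (fun n : ℕ => ((n : ℝ) ^ 2)⁻¹) := by
    simpa using (Real.summable_nat_pow_inv (p := 2)).2 (by norm_num)
  exact h.sum_le_tsum s (fun i _ => by positivity)

noncomputable def invHom : ℕ →* ℝ where
  toFun n := (n : ℝ)⁻¹
  map_one' := by simp
  map_mul' a b := by push_cast; rw [mul_inv]

lemma log_le_exp_primeSum (H : ℝ) (hH : 3 ≤ H) :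
    Real.log H ≤ Real.exp (primeSumUpTo H + 2 * ∑' n : ℕ, ((n : ℝ) ^ 2)⁻¹) := by
  set N := ⌊H⌋₊ with hN
  have h1 : Real.log H ≤ Real.log ((N + 1 : ℕ) : ℝ) := by
    apply Real.log_le_log (by linarith)
    push_cast
    exact (Nat.lt_floor_add_one H).le
  have h2 := log_add_one_le_harmonic N
  have hlt : ∀ {p : ℕ}, p.Prime → ‖invHom p‖ < 1 := by
    intro p hp
    have : (1 : ℝ) < p := by exact_mod_cast hp.one_lt
    simp only [invHom, MonoidHom.coe_mk, OneHom.coe_mk, norm_inv, RCLike.norm_natCast]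
    exact inv_lt_one_of_one_lt₀ this
  obtain ⟨hs1, hs2⟩ :=
    EulerProduct.summable_and_hasSum_smoothNumbers_prod_primesBelow_geometric hlt (N + 1)
  have h3 : ((harmonic N : ℚ) : ℝ) ≤ ∏ p ∈ (N + 1).primesBelow, (1 - invHom p)⁻¹ := by
    have hinj : Function.Injective (fun i : Fin N =>
        (⟨(i : ℕ) + 1, Nat.mem_smoothNumbers_of_lt (by omega) (by omega)⟩ :
          (N + 1).smoothNumbers)) := by
      intro a b hab
      simp only [Subtype.mk.injEq] at hab
      exact Fin.ext (by omega)
    have h4 := sum_le_hasSum (Finset.univ.map ⟨_, hinj⟩) (fun m _ => by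
      simp only [invHom, MonoidHom.coe_mk, OneHom.coe_mk]; positivity) hs2
    rw [Finset.sum_map] at h4
    refine le_trans (le_of_eq ?_) h4
    rw [harmonic, ← Fin.sum_univ_eq_sum_range (fun i => (((i + 1 : ℕ) : ℚ))⁻¹)]
    push_cast
    simp [invHom]
  have h5 : ∏ p ∈ (N + 1).primesBelow, (1 - invHom p)⁻¹ ≤
      ∏ p ∈ (N + 1).primesBelow, Real.exp (1 / (p : ℝ) + 2 * ((p : ℝ) ^ 2)⁻¹) := by
    apply Finset.prod_le_prod
    · intro p hp
      have := hlt (Nat.mem_primesBelow.1 hp).2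
      have := (abs_lt.1 this).2
      exact inv_nonneg.2 (by linarith)
    · intro p hp
      have hp2 : (2 : ℝ) ≤ p := by exact_mod_cast (Nat.mem_primesBelow.1 hp).2.two_le
      simp only [invHom, MonoidHom.coe_mk, OneHom.coe_mk]
      have hx : (p : ℝ)⁻¹ ≤ 1 / 2 := by
        rw [one_div]; exact inv_anti₀ (by norm_num) hp2
      have hx0 : 0 < (p : ℝ)⁻¹ := by positivity
      rw [one_div, ← inv_pow]
      generalize (p : ℝ)⁻¹ = x at hx hx0
      refine le_trans ?_ (Real.add_one_le_exp _)
      rw [inv_le_iff_one_le_mul₀ (by linarith)]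
      nlinarith [mul_pos hx0 hx0]
  rw [← Real.exp_sum, Finset.sum_add_distrib, ← Finset.mul_sum] at h5
  have h6 : ∑ p ∈ (N + 1).primesBelow, 1 / (p : ℝ) = primeSumUpTo H := by
    unfold primeSumUpTo Nat.primesBelow
    apply Finset.sum_congr _ (fun _ _ => rfl)
    ext p
    simp [← hN, Nat.lt_succ_iff]
  rw [h6] at h5
  refine h1.trans (h2.trans (h3.trans (h5.trans (Real.exp_le_exp.2 ?_))))
  linarith [sum_inv_sq_le (N + 1).primesBelow]

lemma exp_moment (t : ℝ) (ht : 0 < t) (N : ℕ) :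
    ∑ q ∈ Finset.Ioc 0 N, Real.exp (t * primeVol q) ≤
      N * Real.exp (t * Real.exp t * ∑' n : ℕ, ((n : ℝ) ^ 2)⁻¹) := by
  classical
  set g : ℕ → ℝ := fun p => Real.exp (t / p) - 1 with hg
  have hg0 : ∀ p, 0 ≤ g p := fun p => by
    have : 0 ≤ t / (p : ℝ) := by positivity
    simp only [hg]; linarith [Real.add_one_le_exp (t / (p : ℝ))]
  set S := (N + 1).primesBelow with hS
  have h1 : ∀ q ∈ Finset.Ioc 0 N, Real.exp (t * primeVol q) =
      ∑ T ∈ S.powerset, if T ⊆ q.primeFactors then ∏ p ∈ T, g p else 0 := by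
    intro q hq
    rw [Finset.mem_Ioc] at hq
    rw [primeVol, Finset.mul_sum, Real.exp_sum]
    have : ∀ p ∈ q.primeFactors, Real.exp (t * (1 / (p : ℝ))) = 1 + g p := by
      intro p _
      simp only [hg]; rw [mul_one_div]; ring
    rw [Finset.prod_congr rfl this, Finset.prod_one_add, ← Finset.sum_filter]
    apply Finset.sum_congr _ (fun _ _ => rfl)
    ext T
    simp only [Finset.mem_powerset, Finset.mem_filter]
    refine ⟨fun h => ⟨fun p hp => ?_, h⟩, fun h => h.2⟩
    have := h hp
    rw [Nat.mem_primesBelow]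
    have h2 := Nat.le_of_mem_primeFactors this
    exact ⟨by omega, Nat.prime_of_mem_primeFactors this⟩
  rw [Finset.sum_congr rfl h1, Finset.sum_comm]
  have h2 : ∀ T ∈ S.powerset,
      ∑ q ∈ Finset.Ioc 0 N, (if T ⊆ q.primeFactors then ∏ p ∈ T, g p else 0) ≤
        N * ∏ p ∈ T, (g p / p) := by
    intro T hT
    rw [Finset.mem_powerset] at hT
    rw [← Finset.sum_filter, Finset.sum_const, nsmul_eq_mul, Finset.prod_div_distrib]
    have hc : ((Finset.Ioc 0 N).filter (fun q => T ⊆ q.primeFactors)).card ≤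
        N / ∏ p ∈ T, p := by
      rw [← Nat.Ioc_filter_dvd_card_eq_div]
      apply Finset.card_le_card
      intro q hq
      rw [Finset.mem_filter] at hq ⊢
      refine ⟨hq.1, Finset.prod_primes_dvd q ?_ ?_⟩
      · intro p hp
        exact (Nat.prime_of_mem_primeFactors (hq.2 hp)).prime
      · intro p hp
        exact Nat.dvd_of_mem_primeFactors (hq.2 hp)
    have hc2 : ((((Finset.Ioc 0 N).filter (fun q => T ⊆ q.primeFactors)).card : ℕ) : ℝ) ≤
        N / ∏ p ∈ T, (p : ℝ) := by
      refine (Nat.cast_le.2 hc).trans (Nat.cast_div_le.trans ?_)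
      push_cast
      exact le_rfl
    calc _ ≤ (N / ∏ p ∈ T, (p : ℝ)) * ∏ p ∈ T, g p :=
          mul_le_mul_of_nonneg_right hc2 (Finset.prod_nonneg fun p _ => hg0 p)
      _ = _ := by ring
  refine (Finset.sum_le_sum h2).trans ?_
  rw [← Finset.mul_sum, ← Finset.prod_one_add]
  apply mul_le_mul_of_nonneg_left _ (Nat.cast_nonneg N)
  refine (Real.prod_one_add_le_exp_sum S (fun p => div_nonneg (hg0 p) (Nat.cast_nonneg p))).trans ?_
  apply Real.exp_le_exp.2
  refine le_trans ?_ (mul_le_mul_of_nonneg_left (sum_inv_sq_le S) (by positivity))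
  rw [Finset.mul_sum]
  apply Finset.sum_le_sum
  intro p hp
  have hp1 : (1 : ℝ) ≤ p := by exact_mod_cast (Nat.mem_primesBelow.1 hp).2.one_lt.le
  have hx : t / (p : ℝ) ≤ t := div_le_self ht.le hp1
  have hgp : g p ≤ t / p * Real.exp t := by
    have a1 := Real.one_sub_le_exp_neg (t / (p : ℝ))
    have a2 : Real.exp (-(t / (p : ℝ))) * Real.exp (t / (p : ℝ)) = 1 := by
      rw [← Real.exp_add]; simp
    have a3 := mul_le_mul_of_nonneg_right a1 (Real.exp_pos (t / (p : ℝ))).le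
    have a4 : t / (p : ℝ) * Real.exp (t / (p : ℝ)) ≤ t / p * Real.exp t :=
      mul_le_mul_of_nonneg_left (Real.exp_le_exp.2 hx) (by positivity)
    simp only [hg]
    linarith
  calc g p / p ≤ (t / p * Real.exp t) / p := by gcongr
    _ = _ := by field_simp

/-- the number of `q ≤ X` with prime volume at least `(1-ε) ∑_{p ≤ H} 1/p`
is `O_A(X (log H)^{-A})`. -/
theorem count_large_prime_volume
    (ε : ℝ) (hε : ε ∈ Set.Ioo (0 : ℝ) (1 / 100)) (A : ℝ) (hA : 100 < A) :
    ∃ C : ℝ, 0 < C ∧ ∀ X : ℝ, 2 ≤ X → ∀ H : ℝ, 3 ≤ H →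
      (Set.ncard {q : ℕ | 1 ≤ q ∧ (q : ℝ) ≤ X ∧
          (1 - ε) * primeSumUpTo H ≤ primeVol q} : ℝ)
        ≤ C * X * Real.log H ^ (-A) := by
  classical
  obtain ⟨hε0, hε1⟩ := hε
  set K := ∑' n : ℕ, ((n : ℝ) ^ 2)⁻¹ with hK
  have h1ε : 0 < 1 - ε := by linarith
  set t := A / (1 - ε) with htdef
  have ht : 0 < t := div_pos (by linarith) h1ε
  have htA : t * (1 - ε) = A := by rw [htdef]; field_simp
  refine ⟨Real.exp (t * Real.exp t * K) * Real.exp (2 * K * A), by positivity, ?_⟩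
  intro X hX H hH
  set P := primeSumUpTo H with hP
  have hset : {q : ℕ | 1 ≤ q ∧ (q : ℝ) ≤ X ∧ (1 - ε) * P ≤ primeVol q} =
      ↑((Finset.Ioc 0 ⌊X⌋₊).filter (fun q => (1 - ε) * P ≤ primeVol q)) := by
    ext q
    simp only [Set.mem_setOf_eq, Finset.coe_filter, Finset.mem_Ioc]
    rw [Nat.le_floor_iff (by linarith : (0 : ℝ) ≤ X)]
    constructor
    · rintro ⟨a, b, c⟩; exact ⟨⟨a, b⟩, c⟩
    · rintro ⟨⟨a, b⟩, c⟩; exact ⟨a, b, c⟩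
  rw [hset, Set.ncard_coe_finset]
  set F := (Finset.Ioc 0 ⌊X⌋₊).filter (fun q => (1 - ε) * P ≤ primeVol q) with hF
  have hm := exp_moment t ht ⌊X⌋₊
  have hlow : (F.card : ℝ) * Real.exp (A * P) ≤
      ∑ q ∈ Finset.Ioc 0 ⌊X⌋₊, Real.exp (t * primeVol q) := by
    calc (F.card : ℝ) * Real.exp (A * P) = ∑ q ∈ F, Real.exp (A * P) := by
          rw [Finset.sum_const, nsmul_eq_mul]
      _ ≤ ∑ q ∈ F, Real.exp (t * primeVol q) := by
          apply Finset.sum_le_sum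
          intro q hq
          apply Real.exp_le_exp.2
          rw [← htA, mul_assoc]
          exact mul_le_mul_of_nonneg_left (Finset.mem_filter.1 hq).2 ht.le
      _ ≤ _ := Finset.sum_le_sum_of_subset_of_nonneg (Finset.filter_subset _ _)
          (fun _ _ _ => (Real.exp_pos _).le)
  have hfl : (⌊X⌋₊ : ℝ) ≤ X := Nat.floor_le (by linarith)
  have hub : (F.card : ℝ) * Real.exp (A * P) ≤ X * Real.exp (t * Real.exp t * K) :=
    hlow.trans (hm.trans (mul_le_mul_of_nonneg_right hfl (Real.exp_pos _).le))
  have hlog := log_le_exp_primeSum H hH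
  have hlogpos : 0 < Real.log H := Real.log_pos (by linarith)
  have hpow : Real.exp (-(A * P)) ≤ Real.exp (2 * K * A) * Real.log H ^ (-A) := by
    have h := Real.rpow_le_rpow_of_nonpos hlogpos hlog (by linarith : -A ≤ 0)
    rw [← Real.exp_mul] at h
    calc Real.exp (-(A * P)) = Real.exp (2 * K * A) * Real.exp ((P + 2 * K) * (-A)) := by
          rw [← Real.exp_add]; congr 1; ring
      _ ≤ _ := mul_le_mul_of_nonneg_left h (Real.exp_pos _).le
  calc (F.card : ℝ) = (F.card : ℝ) * Real.exp (A * P) * Real.exp (-(A * P)) := by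
        rw [mul_assoc, ← Real.exp_add]; simp
    _ ≤ (X * Real.exp (t * Real.exp t * K)) * (Real.exp (2 * K * A) * Real.log H ^ (-A)) :=
        mul_le_mul hub hpow (Real.exp_pos _).le (by positivity)
    _ = _ := by ring
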